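/- Let T be a universal theory in a first-order language L that is κ-unique for some uncountable cardinal κ. Then any two infinite models of T are elementarily equivalent; equivalently, the theory T_∞ of the infinite models of T is a complete (satisfiable) theory. -/

import Mathlib

open FirstOrder Language Cardinal

universe u

/-- `X` generates the `L`-structure `M`: the substructure generated by `X` is all of `M`. -/
def Generates (L : FirstOrder.Language.{u, u}) (M : Type u) [L.Structure M] (X : Set M) : Prop :=
  Substructure.closure L X = ⊤

/-- `M` is `μ`-generated: it is generated by a set of cardinality `μ`. -/
def IsGenerated (L : FirstOrder.Language.{u, u}) (M : Type u) [L.Structure M]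
    (μ : Cardinal.{u}) : Prop :=
  ∃ X : Set M, #X = μ ∧ Generates L M X

/-- `M` is strictly `μ`-generated: it is `μ`-generated but not `ν`-generated for any `ν < μ`. -/
def StrictlyGenerated (L : FirstOrder.Language.{u, u}) (M : Type u) [L.Structure M]
    (μ : Cardinal.{u}) : Prop :=
  IsGenerated L M μ ∧ ∀ ν < μ, ¬ IsGenerated L M ν

/-- A theory `T` is `κ`-unique: it has a strictly `κ`-generated model, and any two strictly
`κ`-generated models of `T` are isomorphic. -/
def KUnique {L : FirstOrder.Language.{u, u}} (T : L.Theory) (κ : Cardinal.{u}) : Prop :=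
  (∃ (M : Type u) (_ : L.Structure M), M ⊨ T ∧ StrictlyGenerated L M κ) ∧
  (∀ (M N : Type u) (_ : L.Structure M) (_ : L.Structure N),
    M ⊨ T → N ⊨ T → StrictlyGenerated L M κ → StrictlyGenerated L N κ →
      Nonempty (M ≃[L] N))

/-- A sentence is universal if it is of the form `∀ x₁ … ∀ xₙ, φ` with `φ` quantifier-free. -/
def IsUniversalSentence {L : FirstOrder.Language.{u, u}} (φ : L.Sentence) : Prop :=
  ∃ (n : ℕ) (ψ : L.BoundedFormula Empty n), ψ.IsQF ∧ φ = ψ.alls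

/-- A theory is universal if every sentence of it is universal. -/
def IsUniversalTheory {L : FirstOrder.Language.{u, u}} (T : L.Theory) : Prop :=
  ∀ φ ∈ T, IsUniversalSentence φ

open Filter

/-- The iterated Fubini power of the ultrafilter `U` along the list `l`, as an ultrafilter on
assignments `I → M`; coordinates off `l` are those of `v₀`. -/
noncomputable def iterUltra {I M : Type u} [DecidableEq I] (U : Ultrafilter M) (v₀ : I → M) :
    List I → Ultrafilter (I → M)
  | [] => pure v₀
  | i :: l => U.bind fun a => (iterUltra U v₀ l).map fun v => Function.update v i a

section IterUltra

variable {I M : Type u}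

theorem DependsOn.update_comp {β : Type*} [DecidableEq I] {P : (I → M) → β} {i : I} {s : Set I}
    (h : DependsOn P (insert i s)) (a : M) :
    DependsOn (fun v => P (Function.update v i a)) s := by
  intro v v' hv
  refine h fun j hj => ?_
  by_cases hji : j = i
  · subst hji; simp
  · simpa [hji] using hv j (hj.resolve_left hji)

theorem DependsOn.update_eq {β : Type*} [DecidableEq I] {P : (I → M) → β} {i : I} {s : Set I}
    (h : DependsOn P s) (hi : i ∉ s) (v : I → M) (a : M) :
    P (Function.update v i a) = P v :=
  h fun j hj => Function.update_of_ne (by rintro rfl; exact hi hj) _ _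

theorem eventually_iterUltra_cons [DecidableEq I] (U : Ultrafilter M) (v₀ : I → M) (i : I)
    (l : List I) (P : (I → M) → Prop) :
    (∀ᶠ v in iterUltra U v₀ (i :: l), P v) ↔
      ∀ᶠ a in U, ∀ᶠ v in iterUltra U v₀ l, P (Function.update v i a) :=
  Iff.rfl

theorem eventually_iterUltra_sublist [DecidableEq I] (U : Ultrafilter M) (v₀ : I → M)
    {l₀ l : List I} (h : l₀.Sublist l) (hl : l.Nodup) {P : (I → M) → Prop}
    (hP : DependsOn P {i | i ∈ l₀}) :
    (∀ᶠ v in iterUltra U v₀ l, P v) ↔ ∀ᶠ v in iterUltra U v₀ l₀, P v := by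
  induction h generalizing P with
  | slnil => rfl
  | @cons l₀ l i h ih =>
    rw [List.nodup_cons] at hl
    rw [eventually_iterUltra_cons]
    simp only [hP.update_eq (fun hi => hl.1 (h.subset hi)), eventually_const]
    exact ih hl.2 hP
  | @cons_cons l₀ l i h ih =>
    rw [List.nodup_cons] at hl
    rw [eventually_iterUltra_cons, eventually_iterUltra_cons]
    refine eventually_congr (Eventually.of_forall fun a => ih hl.2 ?_)
    refine DependsOn.update_comp (s := {i | i ∈ l₀}) ?_ a
    convert hP using 1
    ext j; simp

theorem eventually_iterUltra_map [DecidableEq I] (U : Ultrafilter M) (v₀ : I → M) (f : I → I)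
    (l : List I) (hf : Set.InjOn f {i | i ∈ l}) {P : (I → M) → Prop}
    (hP : DependsOn P {i | i ∈ l}) :
    (∀ᶠ v in iterUltra U v₀ (l.map f), P (v ∘ f)) ↔ ∀ᶠ v in iterUltra U v₀ l, P v := by
  induction l generalizing P with
  | nil =>
    change P (v₀ ∘ f) ↔ P v₀
    exact iff_of_eq (hP fun i hi => by simp at hi)
  | cons i l ih =>
    rw [List.map_cons, eventually_iterUltra_cons, eventually_iterUltra_cons]
    refine eventually_congr (Eventually.of_forall fun a => ?_)
    rw [← ih (hf.mono fun j hj => by simpa using Or.inr hj)]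
    · refine eventually_congr (Eventually.of_forall fun v => iff_of_eq (hP fun j hj => ?_))
      by_cases hji : j = i
      · subst hji; simp
      · have : f j ≠ f i := fun e => hji (hf hj (by simp) e)
        simp [this, hji]
    · refine DependsOn.update_comp (s := {i | i ∈ l}) ?_ a
      convert hP using 1
      ext j; simp

theorem not_eventually_iterUltra_eq [DecidableEq I] [Infinite M] (v₀ : I → M) {j : I}
    {l : List I} (hj : j ∈ l) {f : (I → M) → M} (hf : DependsOn f {j}ᶜ) :
    ¬ ∀ᶠ v in iterUltra (hyperfilter M) v₀ l, v j = f v := by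
  induction l generalizing f with
  | nil => simp at hj
  | cons i l ih =>
    rw [eventually_iterUltra_cons]
    intro h
    by_cases hji : j = i
    · subst hji
      simp only [Function.update_self, hf.update_eq (i := j) (by simp)] at h
      obtain ⟨a, ha⟩ := h.exists
      have h2 : ∀ᶠ b in hyperfilter M, b ≠ a :=
        compl_mem_hyperfilter_of_finite (Set.finite_singleton a)
      obtain ⟨b, hb, hba⟩ := (h.and h2).exists
      obtain ⟨v, h1, h2⟩ := (ha.and hb).exists
      exact hba (h2.trans h1.symm)
    · obtain ⟨a, ha⟩ := h.exists
      refine ih ((List.mem_cons.1 hj).resolve_left hji)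
        (f := fun v => f (Function.update v i a)) ?_ (ha.mono fun v hv => ?_)
      · exact DependsOn.update_comp (hf.mono (Set.subset_insert _ _)) a
      · simpa [hji] using hv

variable [LinearOrder I]

/-- The limit, over finite sets of coordinates, of the iterated powers of `U`. -/
noncomputable def limUltra (U : Ultrafilter M) (v₀ : I → M) : Ultrafilter (I → M) :=
  (Ultrafilter.of (atTop : Filter (Finset I))).bind fun s => iterUltra U v₀ (s.sort (· ≤ ·))

theorem eventually_limUltra (U : Ultrafilter M) (v₀ : I → M) {s : Finset I}
    {P : (I → M) → Prop} (hP : DependsOn P (s : Set I)) :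
    (∀ᶠ v in limUltra U v₀, P v) ↔ ∀ᶠ v in iterUltra U v₀ (s.sort (· ≤ ·)), P v := by
  change (∀ᶠ t : Finset I in Ultrafilter.of (atTop : Filter (Finset I)),
    ∀ᶠ v in iterUltra U v₀ (t.sort (· ≤ ·)), P v) ↔ _
  have h : ∀ᶠ t in Ultrafilter.of (atTop : Filter (Finset I)), s ≤ t :=
    Ultrafilter.of_le _ (eventually_ge_atTop s)
  have h2 : ∀ᶠ t : Finset I in Ultrafilter.of (atTop : Filter (Finset I)),
      ((∀ᶠ v in iterUltra U v₀ (t.sort (· ≤ ·)), P v) ↔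
        ∀ᶠ v in iterUltra U v₀ (s.sort (· ≤ ·)), P v) := by
    refine h.mono fun t hst => eventually_iterUltra_sublist U v₀ ?_ (Finset.sort_nodup _ _) ?_
    · refine List.sublist_of_subperm_of_pairwise (r := (· ≤ ·)) ?_ (Finset.pairwise_sort _ _)
        (Finset.pairwise_sort _ _)
      refine List.subperm_of_subset (Finset.sort_nodup _ _) fun i hi => ?_
      simp only [Finset.mem_sort] at hi ⊢
      exact hst hi
    · simpa using hP
  rw [eventually_congr h2, eventually_const]

/-- Two tuples in a linear order have the same order type. -/
def SameOrderType {ι : Type u} (w w' : ι → I) : Prop :=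
  ∀ i j, w i < w j ↔ w' i < w' j

theorem SameOrderType.symm {ι : Type u} {w w' : ι → I} (h : SameOrderType w w') :
    SameOrderType w' w :=
  fun i j => (h i j).symm

theorem SameOrderType.eq_iff {ι : Type u} {w w' : ι → I} (h : SameOrderType w w') (i j : ι) :
    w i = w j ↔ w' i = w' j := by
  rw [eq_iff_le_not_lt, eq_iff_le_not_lt, ← not_lt, ← not_lt, h j i, h i j]

theorem eventually_limUltra_comp_iff (U : Ultrafilter M) (v₀ : I → M) {ι : Type u} [Finite ι]
    {w w' : ι → I} (h : SameOrderType w w') (P : (ι → M) → Prop) :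
    (∀ᶠ v in limUltra U v₀, P (v ∘ w)) ↔ ∀ᶠ v in limUltra U v₀, P (v ∘ w') := by
  have := Fintype.ofFinite ι
  have dep : ∀ w : ι → I, DependsOn (fun v : I → M => P (v ∘ w)) (Finset.univ.image w : Finset I) := by
    intro w v v' hv
    have : v ∘ w = v' ∘ w := funext fun i => hv _ (by simp)
    simp only [this]
  set f : I → I := Function.extend w w' id with hf
  have hfw : ∀ i, f (w i) = w' i := fun i =>
    Function.FactorsThrough.extend_apply (fun a b hab => (h.eq_iff a b).1 hab) _ _
  have hmono : StrictMonoOn f (Finset.univ.image w : Finset I) := by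
    intro a ha b hb hab
    simp only [Finset.coe_image, Finset.coe_univ, Set.image_univ, Set.mem_range] at ha hb
    obtain ⟨i, rfl⟩ := ha
    obtain ⟨j, rfl⟩ := hb
    rw [hfw, hfw]
    exact (h i j).1 hab
  have himg : (Finset.univ.image w).image f = Finset.univ.image w' := by
    rw [Finset.image_image]
    exact congrArg (Finset.univ.image ·) (funext hfw)
  have hsort : ((Finset.univ.image w).image f).sort (· ≤ ·) =
      ((Finset.univ.image w).sort (· ≤ ·)).map f := by
    set l := (Finset.univ.image w).sort (· ≤ ·) with hl
    have hmem : ∀ {i}, i ∈ l → i ∈ (Finset.univ.image w : Finset I) := fun h =>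
      (Finset.mem_sort _).1 h
    have hnd : (l.map f).Nodup := (Finset.sort_nodup _ _).map_on fun a ha b hb =>
      hmono.injOn (hmem ha) (hmem hb)
    have hset : (Finset.univ.image w).image f = (l.map f).toFinset := by
      ext j
      simp [hl]
    rw [hset, List.toFinset_sort (· ≤ ·) hnd, List.pairwise_map]
    exact (Finset.pairwise_sort _ _).imp_of_mem fun ha hb hab =>
      hmono.monotoneOn (hmem ha) (hmem hb) hab
  rw [eventually_limUltra U v₀ (dep w), eventually_limUltra U v₀ (dep w'), ← himg,
    hsort, ← eventually_iterUltra_map U v₀ f]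
  · refine eventually_congr (Eventually.of_forall fun v => ?_)
    rw [Function.comp_assoc, show f ∘ w = w' from funext hfw]
  · exact hmono.injOn.mono fun i hi => by simpa using hi
  · exact (dep w).mono fun i hi => by simpa using hi

theorem not_eventually_limUltra_eq [Infinite M] (v₀ : I → M) {j : I} {s : Finset I}
    (hj : j ∉ s) {f : (I → M) → M} (hf : DependsOn f (s : Set I)) :
    ¬ ∀ᶠ v in limUltra (hyperfilter M) v₀, v j = f v := by
  rw [eventually_limUltra (s := insert j s) (P := fun v => v j = f v)]
  · refine not_eventually_iterUltra_eq v₀ (by simp) (hf.mono fun i hi => ?_)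
    rintro rfl
    exact hj hi
  · intro v v' hv
    simp only [hv j (by simp), hf fun i hi => hv i (by simp [Finset.mem_coe.1 hi])]

end IterUltra

section EhrenfeuchtMostowski

variable {L : FirstOrder.Language.{u, u}} {I M : Type u} [L.Structure M]

/-- The elements of an ultrapower over `I → M` represented by functions that depend on finitely
many coordinates, all of them in `A`. -/
noncomputable def finiteSupport (F : Ultrafilter (I → M)) (A : Set I) :
    L.Substructure ((F : Filter (I → M)).Product fun _ => M) where
  carrier := {h | ∃ (s : Finset I) (f : (I → M) → M), (s : Set I) ⊆ A ∧ DependsOn f (s : Set I) ∧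
    h = (f : (F : Filter (I → M)).Product fun _ => M)}
  fun_mem := by
    classical
    intro n g x hx
    choose s f hs hf hx using hx
    refine ⟨Finset.univ.biUnion s, fun v => Structure.funMap g fun i => f i v, ?_, ?_, ?_⟩
    · simpa using hs
    · intro v v' hv
      refine congrArg (Structure.funMap g) (funext fun i => hf i fun j hj => hv j ?_)
      simpa using ⟨i, hj⟩
    · rw [funext hx]
      exact Ultraproduct.funMap_cast g f

theorem mem_finiteSupport {F : Ultrafilter (I → M)} {A : Set I}
    {h : (F : Filter (I → M)).Product fun _ => M} :
    h ∈ finiteSupport (L := L) F A ↔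
      ∃ (s : Finset I) (f : (I → M) → M), (s : Set I) ⊆ A ∧ DependsOn f (s : Set I) ∧
        h = (f : (F : Filter (I → M)).Product fun _ => M) :=
  Iff.rfl

theorem isElementary_finiteSupport [Nonempty M] (F : Ultrafilter (I → M)) :
    (finiteSupport (L := L) F Set.univ).IsElementary := by
  classical
  refine Substructure.isElementary_of_exists _ fun n φ x a hφ => ?_
  choose s f hs hf hx using fun i => mem_finiteSupport.1 (x i).2
  obtain ⟨a, rfl⟩ := Quotient.exists_rep a
  let g : (I → M) → M := fun v => Classical.epsilon fun m : M =>
    φ.Realize default (Fin.snoc (fun i => f i v) m : Fin (n + 1) → M)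
  have hg : DependsOn g (Finset.univ.biUnion s : Finset I) := by
    intro v v' hv
    have : (fun i => f i v) = fun i => f i v' :=
      funext fun i => hf i fun j hj => hv j (by simpa using ⟨i, hj⟩)
    simp only [g, this]
  refine ⟨⟨(g : (F : Filter (I → M)).Product fun _ => M), _, g, Set.subset_univ _, hg, rfl⟩, ?_⟩
  have key : ∀ b : (I → M) → M,
      φ.Realize default (Fin.snoc (Subtype.val ∘ x) (b : (F : Filter (I → M)).Product fun _ => M)) ↔
        ∀ᶠ v in F, φ.Realize default (Fin.snoc (fun i => f i v) (b v) : Fin (n + 1) → M) := by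
    intro b
    have h1 := Ultraproduct.boundedFormula_realize_cast (u := F) (M := fun _ => M) φ
      (fun e : Empty => e.elim) (Fin.snoc f b)
    convert h1 using 1
    · refine iff_of_eq (congrArg₂ _ (Subsingleton.elim _ _) (funext fun i => ?_))
      refine Fin.lastCases ?_ (fun i => ?_) i
      · exact (Fin.snoc_last (α := fun _ => _) _ _).trans
          (congrArg _ (Fin.snoc_last (α := fun _ => _) _ _).symm)
      · exact (Fin.snoc_castSucc (α := fun _ => _) _ _ _).trans
          ((hx i).trans (congrArg _ (Fin.snoc_castSucc (α := fun _ => _) _ _ _).symm))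
    · refine iff_of_eq (congrArg (fun p => ∀ᶠ v in (F : Filter (I → M)), p v) (funext fun v => ?_))
      refine congrArg₂ _ (Subsingleton.elim _ _) (funext fun i => ?_)
      refine Fin.lastCases ?_ (fun i => ?_) i <;> simp
  rw [key]
  refine ((key a).1 hφ).mono fun v hv => ?_
  exact Classical.epsilon_spec (p := fun m : M =>
    φ.Realize default (Fin.snoc (fun i => f i v) m : Fin (n + 1) → M)) ⟨_, hv⟩

/-- Every infinite structure is elementarily equivalent to one containing an indiscernible
sequence, with a notion of support for which the terms of the sequence are independent. -/
theorem exists_indiscernible_sequence (L : FirstOrder.Language.{u, u}) (I M : Type u)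
    [LinearOrder I] [L.Structure M] [Infinite M] :
    ∃ (H : Type u) (_ : L.Structure H) (x : I → H) (S : Set I → L.Substructure H),
      L.ElementarilyEquivalent H M ∧ Monotone S ∧ (∀ A i, x i ∈ S A ↔ i ∈ A) ∧
      (∀ h, ∃ s : Finset I, h ∈ S s) ∧
      ∀ (ι : Type u) [Finite ι] (φ : L.Formula ι) (w w' : ι → I), SameOrderType w w' →
        (φ.Realize (x ∘ w) ↔ φ.Realize (x ∘ w')) := by
  classical
  let v₀ : I → M := fun _ => Classical.arbitrary M
  let F := limUltra (hyperfilter M) v₀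
  let E : L.ElementarySubstructure ((F : Filter (I → M)).Product fun _ => M) :=
    ⟨finiteSupport F Set.univ, isElementary_finiteSupport F⟩
  let y : I → (F : Filter (I → M)).Product fun _ => M := fun i =>
    ((fun v => v i : (I → M) → M) : (F : Filter (I → M)).Product fun _ => M)
  have hdep : ∀ i, DependsOn (fun v : I → M => v i) (({i} : Finset I) : Set I) := fun i v v' hv =>
    hv i (by simp)
  refine ⟨E, inferInstance,
    fun i => ⟨y i, {i}, _, Set.subset_univ _, hdep i, rfl⟩,
    fun A => (finiteSupport F A).comap (E.subtype.toEmbedding.toHom), ?_, ?_, ?_, ?_, ?_⟩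
  · refine E.elementarilyEquivalent.trans ?_
    refine (elementarilyEquivalent_iff).2 fun φ => ?_
    rw [Ultraproduct.sentence_realize, eventually_const]
  · rintro A B hAB h ⟨s, f, hs, hf⟩
    exact ⟨s, f, hs.trans hAB, hf⟩
  · intro A i
    constructor
    · rintro ⟨s, f, hs, hf, h⟩
      by_contra hi
      exact not_eventually_limUltra_eq v₀ (fun his => hi (hs his)) hf (Quotient.exact h)
    · intro hi
      exact ⟨{i}, _, by simpa using hi, hdep i, rfl⟩
  · rintro ⟨h, s, f, -, hf⟩
    exact ⟨s, s, f, subset_rfl, hf⟩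
  · intro ι _ φ w w' hw
    rw [← E.subtype.map_formula, ← E.subtype.map_formula]
    refine (Ultraproduct.realize_formula_cast (u := F) (M := fun _ => M) φ
      (fun i v => v (w i))).trans (Iff.trans ?_ (Ultraproduct.realize_formula_cast (u := F)
      (M := fun _ => M) φ (fun i v => v (w' i))).symm)
    exact eventually_limUltra_comp_iff (hyperfilter M) v₀ hw fun z => φ.Realize z

end EhrenfeuchtMostowski

section Closing

theorem mk_iUnion_le_of_forall_le {ι α : Type u} {κ : Cardinal.{u}} (hκ : ℵ₀ ≤ κ) {f : ι → Set α}
    (hι : #ι ≤ κ) (hf : ∀ i, #(f i) ≤ κ) : #(⋃ i, f i) ≤ κ :=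
  calc
    #(⋃ i, f i) ≤ #ι * ⨆ i, #(f i) := mk_iUnion_le f
    _ ≤ κ * κ := mul_le_mul' hι (ciSup_le' hf)
    _ = κ := mul_eq_self hκ

theorem mk_union_le_of_le {α : Type u} {κ : Cardinal.{u}} (hκ : ℵ₀ ≤ κ) {s t : Set α}
    (hs : #s ≤ κ) (ht : #t ≤ κ) : #(s ∪ t : Set α) ≤ κ :=
  (mk_union_le s t).trans ((add_le_add hs ht).trans (add_eq_self hκ).le)

theorem mk_finset_le_of_le {α : Type u} {κ : Cardinal.{u}} (hκ : ℵ₀ ≤ κ) (hα : #α ≤ κ) :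
    #(Finset α) ≤ κ := by
  cases finite_or_infinite α
  · exact (lt_aleph0_of_finite _).le.trans hκ
  · exact (mk_finset_of_infinite α).le.trans hα

/-- One step of closing a set under the finitary set-valued operation `E`. -/
def closeStep {α : Type u} (E : Finset α → Set α) (G : Set α) : Set α :=
  G ∪ ⋃ s : Finset G, E (s.map (Function.Embedding.subtype _))

/-- `G` is closed under the finitary set-valued operation `E`. -/
def IsClosedUnder {α : Type u} (E : Finset α → Set α) (G : Set α) : Prop :=
  ∀ s : Finset α, (s : Set α) ⊆ G → E s ⊆ G

/-- The closure of a set under the finitary set-valued operation `E`. -/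
def closeUnder {α : Type u} (E : Finset α → Set α) (G : Set α) : Set α :=
  ⋃ n : ULift.{u} ℕ, (closeStep E)^[n.down] G

theorem closeStep_subset {α : Type u} {E : Finset α → Set α} {G : Set α} {s : Finset α}
    (hs : (s : Set α) ⊆ G) : E s ⊆ closeStep E G := by
  classical
  refine Set.Subset.trans ?_ Set.subset_union_right
  refine Set.Subset.trans ?_ (Set.subset_iUnion _ (s.subtype (· ∈ G)))
  rw [Finset.subtype_map_of_mem fun i hi => hs hi]

theorem subset_closeUnder {α : Type u} (E : Finset α → Set α) (G : Set α) : G ⊆ closeUnder E G :=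
  Set.subset_iUnion (fun n : ULift.{u} ℕ => (closeStep E)^[n.down] G) ⟨0⟩

theorem exists_subset_of_finset_subset_iUnion {ι α : Type*} [Nonempty ι] {f : ι → Set α}
    (hf : Directed (· ⊆ ·) f) (s : Finset α) (hs : (s : Set α) ⊆ ⋃ i, f i) :
    ∃ i, (s : Set α) ⊆ f i :=
  hf.exists_mem_subset_of_finset_subset_biUnion hs

theorem isClosedUnder_closeUnder {α : Type u} (E : Finset α → Set α) (G : Set α) :
    IsClosedUnder E (closeUnder E G) := by
  intro s hs
  have hmono : Monotone fun n : ULift.{u} ℕ => (closeStep E)^[n.down] G := fun m n hmn =>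
    Function.monotone_iterate_of_id_le (f := closeStep E) (fun _ => Set.subset_union_left) hmn G
  obtain ⟨⟨n⟩, hn⟩ := exists_subset_of_finset_subset_iUnion hmono.directed_le s hs
  refine (closeStep_subset hn).trans ?_
  rw [← Function.iterate_succ_apply' (closeStep E)]
  exact Set.subset_iUnion (fun n : ULift.{u} ℕ => (closeStep E)^[n.down] G) ⟨n + 1⟩

theorem mk_closeUnder_le {α : Type u} {E : Finset α → Set α} {G : Set α} {κ : Cardinal.{u}}
    (hκ : ℵ₀ ≤ κ) (hE : ∀ s, #(E s) ≤ κ) (hG : #G ≤ κ) : #(closeUnder E G) ≤ κ := by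
  refine mk_iUnion_le_of_forall_le hκ (by simpa using hκ) ?_
  rintro ⟨n⟩
  induction n with
  | zero => exact hG
  | succ n ih =>
    rw [Function.iterate_succ_apply']
    exact mk_union_le_of_le hκ ih
      (mk_iUnion_le_of_forall_le hκ (mk_finset_le_of_le hκ ih) fun s => hE _)

end Closing

section Homogeneity

variable {I : Type u} [LinearOrder I]

/-- Any two finite subsets of `J`, one below the other, are separated by an element of `J`. -/
def IsDenseSubset (J : Set I) : Prop :=
  ∀ s t : Finset I, (s : Set I) ⊆ J → (t : Set I) ⊆ J → (∀ a ∈ s, ∀ b ∈ t, a < b) →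
    ∃ j ∈ J, (∀ a ∈ s, a < j) ∧ ∀ b ∈ t, j < b

theorem isDenseSubset_univ [DenselyOrdered I] [NoMinOrder I] [NoMaxOrder I] [Nonempty I] :
    IsDenseSubset (Set.univ : Set I) := fun s t _ _ h =>
  (Order.exists_between_finsets s t h).imp fun _ hj => ⟨trivial, hj⟩

theorem exists_countable_isDenseSubset [DenselyOrdered I] [NoMinOrder I] [NoMaxOrder I]
    [Nonempty I] (A : Finset I) : ∃ J : Set I, (A : Set I) ⊆ J ∧ J.Countable ∧ IsDenseSubset J := by
  classical
  have h : ∀ p : Finset I × Finset I, ∃ j : I, (∀ x ∈ p.1, ∀ y ∈ p.2, x < y) →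
      (∀ a ∈ p.1, a < j) ∧ ∀ b ∈ p.2, j < b := by
    intro p
    by_cases hp : ∀ x ∈ p.1, ∀ y ∈ p.2, x < y
    · exact (Order.exists_between_finsets _ _ hp).imp fun _ hj _ => hj
    · exact ⟨Classical.arbitrary I, fun h => absurd h hp⟩
  choose f hf using h
  let E : Finset I → Set I := fun r => ((r.powerset ×ˢ r.powerset).image f : Finset I)
  refine ⟨closeUnder E A, subset_closeUnder E A, ?_, ?_⟩
  · refine le_aleph0_iff_set_countable.1 (mk_closeUnder_le le_rfl (fun s => ?_) ?_)
    · exact (lt_aleph0_of_finite _).le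
    · exact (lt_aleph0_of_finite _).le
  · intro s t hs ht hst
    refine ⟨f (s, t), ?_, hf (s, t) hst⟩
    refine isClosedUnder_closeUnder E A (s ∪ t) (by simpa using ⟨hs, ht⟩) ?_
    exact Finset.mem_coe.2 (Finset.mem_image_of_mem f (Finset.mem_product.2
      ⟨Finset.mem_powerset.2 Finset.subset_union_left,
        Finset.mem_powerset.2 Finset.subset_union_right⟩))

theorem SameOrderType.exists_extension_one {J : Set I} (hJ : IsDenseSubset J) {ι : Type u}
    [Finite ι] {w w' : ι → I} (h : SameOrderType w w') (hw' : ∀ k, w' k ∈ J) (i : I) :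
    ∃ j ∈ J, ∀ k, (w k < i ↔ w' k < j) ∧ (i < w k ↔ j < w' k) := by
  classical
  have := Fintype.ofFinite ι
  by_cases hi : ∃ k, w k = i
  · obtain ⟨k₀, rfl⟩ := hi
    exact ⟨w' k₀, hw' k₀, fun k => ⟨h k k₀, h k₀ k⟩⟩
  push Not at hi
  obtain ⟨j, hjJ, hj₁, hj₂⟩ := hJ ((Finset.univ.filter fun k => w k < i).image w')
    ((Finset.univ.filter fun k => i < w k).image w')
    (by simp only [Finset.coe_image]; rintro _ ⟨k, -, rfl⟩; exact hw' k)
    (by simp only [Finset.coe_image]; rintro _ ⟨k, -, rfl⟩; exact hw' k)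
    (by
      simp only [Finset.mem_image, Finset.mem_filter, Finset.mem_univ, true_and]
      rintro _ ⟨a, ha, rfl⟩ _ ⟨b, hb, rfl⟩
      exact (h a b).1 (ha.trans hb))
  have h₁ : ∀ k, w k < i → w' k < j := fun k hk => hj₁ _ (by simpa using ⟨k, hk, rfl⟩)
  have h₂ : ∀ k, i < w k → j < w' k := fun k hk => hj₂ _ (by simpa using ⟨k, hk, rfl⟩)
  refine ⟨j, hjJ, fun k => ⟨⟨h₁ k, fun hk => ?_⟩, ⟨h₂ k, fun hk => ?_⟩⟩⟩
  · exact ((hi k).lt_or_gt).resolve_right fun hk' => hk.not_gt (h₂ k hk')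
  · exact ((hi k).lt_or_gt).resolve_left fun hk' => hk.not_gt (h₁ k hk')

theorem SameOrderType.exists_extension {J : Set I} (hJ : IsDenseSubset J) {ι : Type u}
    [Finite ι] {w w' : ι → I} (h : SameOrderType w w') (hw' : ∀ k, w' k ∈ J) {ι' : Type u}
    [Finite ι'] (v : ι' → I) :
    ∃ v' : ι' → I, (∀ k, v' k ∈ J) ∧ SameOrderType (Sum.elim w v) (Sum.elim w' v') := by
  induction ι' using Finite.induction_empty_option with
  | of_equiv e ih =>
    obtain ⟨v', hv', hvv⟩ := ih (v ∘ e)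
    refine ⟨v' ∘ e.symm, fun k => hv' _, ?_⟩
    intro a b
    have := hvv (a.map id e.symm) (b.map id e.symm)
    cases a <;> cases b <;> simpa using this
  | h_empty =>
    refine ⟨PEmpty.elim, fun k => k.elim, ?_⟩
    rintro (a | a) (b | b)
    · exact h a b
    all_goals cases ‹PEmpty›
  | h_option ih =>
    obtain ⟨v', hv', hvv⟩ := ih (v ∘ some)
    obtain ⟨j, hj, hjj⟩ := hvv.exists_extension_one hJ
      (by rintro (k | k) <;> simp [hw', hv']) (v none)
    refine ⟨fun k => k.elim j v', ?_, ?_⟩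
    · rintro (_ | k)
      · exact hj
      · exact hv' k
    · rintro (a | _ | a) (b | _ | b)
      · exact h a b
      · exact (hjj (Sum.inl a)).1
      · exact hvv (Sum.inl a) (Sum.inr b)
      · exact (hjj (Sum.inl b)).2
      · simp
      · exact (hjj (Sum.inr b)).2
      · exact hvv (Sum.inr a) (Sum.inl b)
      · exact (hjj (Sum.inr a)).1
      · exact hvv (Sum.inr a) (Sum.inr b)

end Homogeneity

section CountableWitnesses

variable {L : FirstOrder.Language.{u, u}} {I : Type u}

/-- `x` is a quantifier-free indiscernible sequence. -/
def IsQFIndiscernible (L : FirstOrder.Language.{u, u}) [LinearOrder I] {U : Type u} [L.Structure U]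
    (x : I → U) : Prop :=
  ∀ (ι : Type u) [Finite ι] (φ : L.Formula ι), φ.IsQF → ∀ w w' : ι → I, SameOrderType w w' →
    (φ.Realize (x ∘ w) ↔ φ.Realize (x ∘ w'))

/-- Finitely generated substructures have countable sets of parameters generating witnesses for
all the existential statements over them. -/
def HasCountableWitnesses (L : FirstOrder.Language.{u, u}) (U : Type u) [L.Structure U] : Prop :=
  ∀ s : Finset U, ∃ Y : Set U, Y.Countable ∧
    ∀ (n : ℕ) (φ : L.BoundedFormula Empty (n + 1)) (a : Fin n → U),
      (∀ i, a i ∈ Substructure.closure L (s : Set U)) → ∀ b,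
      φ.Realize default (Fin.snoc a b : Fin (n + 1) → U) →
        ∃ b' ∈ Substructure.closure L Y, φ.Realize default (Fin.snoc a b' : Fin (n + 1) → U)

theorem HasCountableWitnesses.of_equiv {U V : Type u} [L.Structure U] [L.Structure V]
    (h : HasCountableWitnesses L U) (e : U ≃[L] V) : HasCountableWitnesses L V := by
  classical
  intro s
  obtain ⟨Y, hY, hYw⟩ := h (s.map e.symm.toEquiv.toEmbedding)
  refine ⟨e '' Y, hY.image e, fun n φ a ha b hφ => ?_⟩
  have hcl : ∀ (Z : Set U) (z : U), z ∈ Substructure.closure L Z →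
      e z ∈ Substructure.closure L (e '' Z) := by
    intro Z z hz
    have := Substructure.mem_map_of_mem e.toHom hz
    rwa [Substructure.map_closure] at this
  have hcl' : ∀ (Z : Set V) (z : V), z ∈ Substructure.closure L Z →
      e.symm z ∈ Substructure.closure L (e.symm '' Z) := by
    intro Z z hz
    have := Substructure.mem_map_of_mem e.symm.toHom hz
    rwa [Substructure.map_closure] at this
  have hreal : ∀ (a : Fin n → U) (b : U),
      φ.Realize default (Fin.snoc (e ∘ a) (e b) : Fin (n + 1) → V) ↔
        φ.Realize default (Fin.snoc a b : Fin (n + 1) → U) := by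
    intro a b
    rw [← Fin.comp_snoc, ← StrongHomClass.realize_boundedFormula e φ,
      Subsingleton.elim (e ∘ default) default]
  obtain ⟨b', hb', hφ'⟩ := hYw n φ (e.symm ∘ a)
    (fun i => by simpa using! hcl' _ _ (ha i)) (e.symm b) (by
      rw [← hreal]
      convert hφ using 2
      · ext; simp
      · simp)
  refine ⟨e b', hcl _ _ hb', ?_⟩
  rw [← hreal] at hφ'
  convert hφ' using 2
  ext; simp

theorem exists_term_realize_eq {U : Type u} [L.Structure U] {x : I → U} {A : Set I} {b : U}
    (hb : b ∈ Substructure.closure L (x '' A)) : ∃ t : L.Term A, t.realize (x ∘ (↑)) = b := by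
  obtain ⟨t, rfl⟩ := Substructure.mem_closure_iff_exists_term.1 hb
  choose g hg hxg using fun y : x '' A => y.2
  refine ⟨t.relabel fun y => ⟨g y, hg y⟩, ?_⟩
  rw [Term.realize_relabel]
  exact congrArg (fun v => Term.realize v t) (funext hxg)

theorem exists_finset_term_realize_eq {U : Type u} [L.Structure U] {x : I → U} {A : Set I} {b : U}
    (hb : b ∈ Substructure.closure L (x '' A)) :
    ∃ (s : Finset I) (t : L.Term s), (s : Set I) ⊆ A ∧ t.realize (x ∘ (↑)) = b := by
  classical
  obtain ⟨t, rfl⟩ := exists_term_realize_eq hb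
  refine ⟨t.varFinset.map (Function.Embedding.subtype _),
    t.restrictVar fun a => ⟨a.1, Finset.mem_map_of_mem _ a.2⟩, ?_, ?_⟩
  · simp
  · exact Term.realize_restrictVar _ fun a => rfl

variable [LinearOrder I] {U : Type u} [L.Structure U] {x : I → U}

theorem IsQFIndiscernible.realize_iff [DenselyOrdered I] [NoMinOrder I] [NoMaxOrder I] [Nonempty I]
    (hx : IsQFIndiscernible L x) (hgen : Substructure.closure L (Set.range x) = ⊤) {k : ℕ}
    (φ : L.BoundedFormula Empty k) {ι : Type u} [Finite ι] (ts : Fin k → L.Term ι) {w w' : ι → I}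
    (h : SameOrderType w w') :
    φ.Realize default (fun i => (ts i).realize (x ∘ w)) ↔
      φ.Realize default (fun i => (ts i).realize (x ∘ w')) := by
  have hsub : ∀ {k : ℕ} {ι : Type u} (ts : Fin k → L.Term ι) (v : ι → U) (t : L.Term (Empty ⊕ Fin k)),
      t.realize (Sum.elim default fun i => (ts i).realize v) =
        (t.subst (Sum.elim Empty.elim ts)).realize v := by
    intro k ι ts v t
    rw [Term.realize_subst]
    refine congrArg (fun v => Term.realize v t) (funext ?_)
    rintro (e | i)
    · exact e.elim
    · rfl
  induction φ generalizing ι with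
  | falsum => rfl
  | equal t₁ t₂ =>
    have := hx ι ((t₁.subst (Sum.elim Empty.elim ts)).equal (t₂.subst (Sum.elim Empty.elim ts)))
      (BoundedFormula.IsAtomic.equal _ _).isQF w w' h
    rw [Formula.realize_equal, Formula.realize_equal] at this
    simpa only [BoundedFormula.Realize, hsub] using this
  | rel R tt =>
    have := hx ι (R.formula fun i => (tt i).subst (Sum.elim Empty.elim ts))
      (BoundedFormula.IsAtomic.rel _ _).isQF w w' h
    rw [Formula.realize_rel, Formula.realize_rel] at this
    simpa only [BoundedFormula.Realize, hsub] using this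
  | imp φ ψ ih₁ ih₂ => exact imp_congr (ih₁ ts h) (ih₂ ts h)
  | all φ ih =>
    have key : ∀ w w' : ι → I, SameOrderType w w' →
        φ.all.Realize default (fun i => (ts i).realize (x ∘ w)) →
          φ.all.Realize default (fun i => (ts i).realize (x ∘ w')) := by
      intro w w' h hφ b
      obtain ⟨s, t, -, rfl⟩ := exists_finset_term_realize_eq (L := L) (x := x) (A := Set.univ)
        (b := b) (by rw [Set.image_univ, hgen]; trivial)
      obtain ⟨u, -, hu⟩ := h.symm.exists_extension isDenseSubset_univ (fun _ => trivial)
        ((↑) : s → I)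
      have h1 := hφ (t.realize (x ∘ u))
      have h2 := ih (Fin.snoc (fun i => (ts i).relabel Sum.inl) (t.relabel Sum.inr)) hu
      have h3 : ∀ (w : ι → I) (u : s → I),
          (fun i => ((Fin.snoc (fun i => (ts i).relabel Sum.inl) (t.relabel Sum.inr) :
            Fin _ → L.Term (ι ⊕ s)) i).realize (x ∘ Sum.elim w u)) =
          (Fin.snoc (fun i => (ts i).realize (x ∘ w)) (t.realize (x ∘ u)) : Fin _ → U) := by
        intro w u
        refine funext (Fin.lastCases ?_ fun i => ?_)
        · simp [Function.comp_assoc]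
        · simp [Function.comp_assoc]
      rw [h3, h3] at h2
      exact h2.2 h1
    exact ⟨key w w' h, key w' w h.symm⟩

theorem IsQFIndiscernible.hasCountableWitnesses [DenselyOrdered I] [NoMinOrder I] [NoMaxOrder I]
    [Nonempty I] (hx : IsQFIndiscernible L x)
    (hgen : Substructure.closure L (Set.range x) = ⊤) : HasCountableWitnesses L U := by
  classical
  intro s
  have hmem : ∀ b : U, b ∈ Substructure.closure L (x '' Set.univ) := fun b => by
    rw [Set.image_univ, hgen]; trivial
  choose supp tm _ htm using fun b => exists_finset_term_realize_eq (hmem b)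
  let A : Finset I := s.biUnion supp
  obtain ⟨J, hAJ, hJc, hJ⟩ := exists_countable_isDenseSubset A
  have hterm : ∀ {ι : Type u} (v : ι → U) (Z : Set U) (t : L.Term ι), (∀ i, v i ∈ Z) →
      t.realize v ∈ Substructure.closure L Z := by
    intro ι v Z t hv
    exact Term.realize_mem _ _ fun i => Substructure.subset_closure (hv i)
  have hsA : (s : Set U) ⊆ Substructure.closure L (x '' A) := by
    intro b hb
    rw [← htm b]
    refine hterm _ _ _ fun i => ⟨i, ?_, rfl⟩
    exact Finset.mem_coe.2 (Finset.mem_biUnion.2 ⟨b, hb, i.2⟩)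
  refine ⟨x '' J, hJc.image x, fun n φ a ha b hφ => ?_⟩
  choose ts hts using fun i => exists_term_realize_eq
    (Substructure.closure_le.2 hsA (ha i))
  obtain ⟨u, huJ, hu⟩ := SameOrderType.exists_extension hJ
    (w := ((↑) : ↥(A : Set I) → I)) (w' := (↑)) (fun _ _ => Iff.rfl) (fun k => hAJ k.2)
    ((↑) : supp b → I)
  refine ⟨(tm b).realize (x ∘ u), hterm _ _ _ fun i => ⟨u i, huJ i, rfl⟩, ?_⟩
  have h2 := hx.realize_iff hgen φ
    (Fin.snoc (fun i => (ts i).relabel Sum.inl) ((tm b).relabel Sum.inr)) hu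
  have h3 : ∀ (u : supp b → I),
      (fun i => ((Fin.snoc (fun i => (ts i).relabel Sum.inl) ((tm b).relabel Sum.inr) :
        Fin _ → L.Term (↥(A : Set I) ⊕ supp b)) i).realize (x ∘ Sum.elim (↑) u)) =
      (Fin.snoc a ((tm b).realize (x ∘ u)) : Fin _ → U) := by
    intro u
    refine funext (Fin.lastCases ?_ fun i => ?_)
    · simp [Function.comp_assoc]
    · simp [Function.comp_assoc, ← hts]
  rw [h3, h3, htm] at h2
  exact h2.1 hφ

end CountableWitnesses

section Reflection

theorem mk_Iio_aleph_one_ord_lt (β : (ℵ_ 1 : Cardinal.{u}).ord.ToType) : #(Set.Iio β) < ℵ_ 1 := by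
  simpa using mk_Iio_lt β

theorem exists_forall_lt_of_countable {Y : Type*} [Countable Y]
    (f : Y → (ℵ_ 1 : Cardinal.{u}).ord.ToType) : ∃ β, ∀ y, f y < β := by
  by_contra! h
  have hIio : ∀ β : (ℵ_ 1 : Cardinal.{u}).ord.ToType, (Set.Iic β).Countable := fun β => by
    rw [← Set.Iio_insert]
    exact (le_aleph0_iff_set_countable.1
      (lt_aleph_one_iff.1 (mk_Iio_aleph_one_ord_lt β))).insert β
  have hcount : (Set.univ : Set (ℵ_ 1 : Cardinal.{u}).ord.ToType).Countable := by
    refine (Set.countable_iUnion fun y => hIio (f y)).mono fun β _ => ?_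
    obtain ⟨y, hy⟩ := h β
    exact Set.mem_iUnion.2 ⟨y, hy⟩
  have := le_aleph0_iff_set_countable.2 hcount
  rw [mk_univ, mk_ord_toType] at this
  exact this.not_gt aleph0_lt_aleph_one

variable {L : FirstOrder.Language.{u, u}} {H : Type u} [L.Structure H]

theorem exists_finset_mem_closure {G : Set H} {b : H} (hb : b ∈ Substructure.closure L G) :
    ∃ s : Finset H, (s : Set H) ⊆ G ∧ b ∈ Substructure.closure L (s : Set H) := by
  obtain ⟨s, t, hs, rfl⟩ := exists_finset_term_realize_eq (x := id) (A := G) (by simpa using hb)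
  exact ⟨s, hs, Term.realize_mem _ _ fun i => Substructure.subset_closure i.2⟩

theorem exists_finset_forall_mem_closure {ι : Type*} [Finite ι] {G : Set H} {a : ι → H}
    (ha : ∀ i, a i ∈ Substructure.closure L G) :
    ∃ s : Finset H, (s : Set H) ⊆ G ∧ ∀ i, a i ∈ Substructure.closure L (s : Set H) := by
  classical
  have := Fintype.ofFinite ι
  choose s hs has using fun i => exists_finset_mem_closure (ha i)
  refine ⟨Finset.univ.biUnion s, by simpa using hs, fun i => ?_⟩
  refine Substructure.closure_mono ?_ (has i)
  exact Finset.coe_subset.2 (Finset.subset_biUnion_of_mem s (Finset.mem_univ i))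

/-- The closures of the sets that contain `X`, have at most `κ` elements and are closed under `E`
reflect `φ`. -/
def Reflects (X : Set H) (κ : Cardinal.{u}) {n : ℕ} (φ : L.BoundedFormula Empty n)
    (E : Finset H → Set H) : Prop :=
  ∀ G : Set H, X ⊆ G → #G ≤ κ → IsClosedUnder E G → ∀ xs : Fin n → Substructure.closure L G,
    φ.Realize default xs ↔ φ.Realize default (fun i => (xs i : H))

theorem Reflects.not {X : Set H} {κ : Cardinal.{u}} {n : ℕ} {φ : L.BoundedFormula Empty n}
    {E : Finset H → Set H} (h : Reflects X κ φ E) : Reflects X κ φ.not E :=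
  fun G hX hG hE xs => not_congr (h G hX hG hE xs)

variable {X : Set H} {κ : Cardinal.{u}}

theorem Reflects.exists_witnesses (hκ : ℵ₀ < κ) (hX : #X ≤ κ)
    (hw : ∀ G : Set H, X ⊆ G → #G ≤ κ → HasCountableWitnesses L (Substructure.closure L G))
    {n : ℕ} {φ : L.BoundedFormula Empty (n + 1)} {E : Finset H → Set H} (hEκ : ∀ s, #(E s) ≤ κ)
    (hE : Reflects X κ φ E) (s : Finset H) :
    ∃ D : Set H, #D ≤ κ ∧ ∀ a : Fin n → H, (∀ i, a i ∈ Substructure.closure L (s : Set H)) →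
      ∀ b, φ.Realize default (Fin.snoc a b : Fin (n + 1) → H) →
        ∃ b' ∈ Substructure.closure L D, φ.Realize default (Fin.snoc a b' : Fin (n + 1) → H) := by
  by_contra! hD
  have hκ₁ : ℵ_ 1 ≤ κ := by
    rw [← succ_aleph0]; exact Order.succ_le_of_lt hκ
  have hD' : ∀ D : Set H, ∃ (a : Fin n → H) (b : H), #D ≤ κ →
      (∀ i, a i ∈ Substructure.closure L (s : Set H)) ∧
      φ.Realize default (Fin.snoc a b : Fin (n + 1) → H) ∧
      ∀ b' ∈ Substructure.closure L D, ¬ φ.Realize default (Fin.snoc a b' : Fin (n + 1) → H) := by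
    intro D
    by_cases h : #D ≤ κ
    · obtain ⟨a, ha, b, hb, h'⟩ := hD D h
      exact ⟨a, b, fun _ => ⟨ha, hb, h'⟩⟩
    · obtain ⟨a, ha, b, hb, h'⟩ := hD ∅ (by simp)
      exact ⟨a, b, fun h'' => absurd h'' h⟩
  choose a d had using hD'
  let Ω := (ℵ_ 1 : Cardinal.{u}).ord.ToType
  obtain ⟨G, hG⟩ : ∃ G : Ω → Set H, ∀ β, G β =
      closeUnder E ((X ∪ s) ∪ ⋃ γ : Set.Iio β, insert (d (G γ)) (G γ)) :=
    ⟨WellFoundedLT.fix fun β G =>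
      closeUnder E ((X ∪ s) ∪ ⋃ γ : Set.Iio β, insert (d (G γ γ.2)) (G γ γ.2)),
      fun β => WellFoundedLT.fix_eq _ β⟩
  have hbase : ∀ β, (X ∪ s) ∪ ⋃ γ : Set.Iio β, insert (d (G γ)) (G γ) ⊆ G β := fun β =>
    (subset_closeUnder E _).trans (hG β).ge
  have hXG : ∀ β, X ⊆ G β := fun β =>
    (Set.subset_union_left.trans Set.subset_union_left).trans (hbase β)
  have hsG : ∀ β, (s : Set H) ⊆ G β := fun β =>
    (Set.subset_union_right.trans Set.subset_union_left).trans (hbase β)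
  have hins : ∀ {γ β}, γ < β → insert (d (G γ)) (G γ) ⊆ G β := fun {γ β} h =>
    ((Set.subset_iUnion (fun γ : Set.Iio β => insert (d (G γ)) (G γ)) ⟨γ, h⟩).trans
      Set.subset_union_right).trans (hbase β)
  have hmono : Monotone G := by
    intro γ β h
    rcases h.eq_or_lt with rfl | h
    · rfl
    · exact (Set.subset_insert _ _).trans (hins h)
  have hcard : ∀ β, #(G β) ≤ κ := by
    intro β
    induction β using WellFoundedLT.induction with
    | ind β ih =>
      rw [hG]
      refine mk_closeUnder_le hκ.le hEκ (mk_union_le_of_le hκ.le (mk_union_le_of_le hκ.le hX ?_)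
        (mk_iUnion_le_of_forall_le hκ.le ?_ ?_))
      · exact (lt_aleph0_of_finite _).le.trans hκ.le
      · exact (mk_Iio_aleph_one_ord_lt β).le.trans hκ₁
      · intro γ
        rw [Set.insert_eq]
        exact mk_union_le_of_le hκ.le ((lt_aleph0_of_finite _).le.trans hκ.le) (ih γ γ.2)
  obtain ⟨β₀, -⟩ := exists_forall_lt_of_countable (Empty.elim)
  have : Nonempty Ω := ⟨β₀⟩
  let G' := ⋃ β, G β
  have hXG' : X ⊆ G' := (hXG β₀).trans (Set.subset_iUnion G β₀)
  have hcard' : #G' ≤ κ := mk_iUnion_le_of_forall_le hκ.le (by rwa [mk_ord_toType]) hcard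
  have hclosed : IsClosedUnder E G' := by
    intro t ht
    obtain ⟨β, hβ⟩ := exists_subset_of_finset_subset_iUnion hmono.directed_le t ht
    refine Set.Subset.trans ?_ (Set.subset_iUnion G β)
    rw [hG] at hβ ⊢
    exact isClosedUnder_closeUnder _ _ t hβ
  let S := Substructure.closure L G'
  have hval : ∀ Z : Set S, (Substructure.closure L Z).map S.subtype.toHom =
      Substructure.closure L (Subtype.val '' Z) := fun Z => Substructure.map_closure _ _
  have hsG' : (s : Set H) ⊆ G' := (hsG β₀).trans (Set.subset_iUnion G β₀)
  let e : {i // i ∈ s} ↪ S := ⟨fun i => ⟨i, Substructure.subset_closure (hsG' i.2)⟩,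
    fun i j h => Subtype.ext (congrArg (fun z : S => (z : H)) h)⟩
  obtain ⟨Y, hYc, hY⟩ := hw G' hXG' hcard' (s.attach.map e)
  have hYβ : ∀ y : Y, ∃ β, (y : S).1 ∈ Substructure.closure L (G β) := by
    intro y
    obtain ⟨t, ht, hyt⟩ := exists_finset_mem_closure (y : S).2
    obtain ⟨β, hβ⟩ := exists_subset_of_finset_subset_iUnion hmono.directed_le t ht
    exact ⟨β, Substructure.closure_mono hβ hyt⟩
  choose f hf using hYβ
  have := hYc.to_subtype
  obtain ⟨β, hβ⟩ := exists_forall_lt_of_countable f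
  obtain ⟨β', hβ'⟩ := exists_forall_lt_of_countable (fun _ : Unit => β)
  obtain ⟨ha, hd, hb⟩ := had (G β) (hcard β)
  have hsS : Substructure.closure L (s : Set H) ≤ S := Substructure.closure_mono hsG'
  have hdS : d (G β) ∈ S := Substructure.subset_closure
    (Set.subset_iUnion G β' (hins (hβ' ()) (Set.mem_insert _ _)))
  have hreal : ∀ b : S,
      φ.Realize default (Fin.snoc (fun i => ⟨a (G β) i, hsS (ha i)⟩) b : Fin (n + 1) → S) ↔
        φ.Realize default (Fin.snoc (a (G β)) b : Fin (n + 1) → H) := by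
    intro b
    rw [hE G' hXG' hcard' hclosed]
    refine iff_of_eq (congrArg _ (funext (Fin.lastCases ?_ fun i => ?_))) <;> simp
  obtain ⟨b', hb'Y, hb'⟩ := hY n φ (fun i => ⟨a (G β) i, hsS (ha i)⟩) (fun i => by
    have h1 := ha i
    obtain ⟨z, hz, hzi⟩ : a (G β) i ∈
        (Substructure.closure L (s.attach.map e : Set S)).map S.subtype.toHom := by
      rw [hval]
      refine Substructure.closure_mono ?_ h1
      intro j hj
      exact ⟨e ⟨j, hj⟩, Finset.mem_coe.2 (Finset.mem_map_of_mem e (Finset.mem_attach _ _)), rfl⟩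
    rwa [show (⟨a (G β) i, hsS (ha i)⟩ : S) = z from Subtype.ext hzi.symm])
    ⟨d (G β), hdS⟩ ((hreal _).2 hd)
  refine hb b' ?_ ((hreal b').1 hb')
  have h1 : (b' : H) ∈ (Substructure.closure L Y).map S.subtype.toHom := ⟨b', hb'Y, rfl⟩
  rw [hval] at h1
  refine Substructure.closure_le.2 ?_ h1
  rintro _ ⟨y, hy, rfl⟩
  exact Substructure.closure_mono (hmono (hβ ⟨y, hy⟩).le) (hf ⟨y, hy⟩)

theorem exists_reflects (hκ : ℵ₀ < κ) (hX : #X ≤ κ)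
    (hw : ∀ G : Set H, X ⊆ G → #G ≤ κ → HasCountableWitnesses L (Substructure.closure L G))
    {n : ℕ} (φ : L.BoundedFormula Empty n) :
    ∃ E : Finset H → Set H, (∀ s, #(E s) ≤ κ) ∧ Reflects X κ φ E := by
  have hatom : ∀ {n : ℕ} {φ : L.BoundedFormula Empty n}, φ.IsQF →
      ∃ E : Finset H → Set H, (∀ s, #(E s) ≤ κ) ∧ Reflects X κ φ E := by
    intro n φ hφ
    refine ⟨fun _ => ∅, by simp, fun G _ _ _ xs => ?_⟩
    rw [← hφ.realize_embedding (Substructure.closure L G).subtype]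
    exact iff_of_eq (congrArg₂ _ (Subsingleton.elim _ _) rfl)
  induction φ with
  | falsum => exact hatom .falsum
  | equal t₁ t₂ => exact hatom (.of_isAtomic (.equal t₁ t₂))
  | rel R ts => exact hatom (.of_isAtomic (.rel R ts))
  | imp φ ψ ih₁ ih₂ =>
    obtain ⟨E₁, hE₁, h₁⟩ := ih₁
    obtain ⟨E₂, hE₂, h₂⟩ := ih₂
    refine ⟨fun s => E₁ s ∪ E₂ s, fun s => mk_union_le_of_le hκ.le (hE₁ s) (hE₂ s),
      fun G hXG hG hE xs => imp_congr ?_ ?_⟩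
    · exact h₁ G hXG hG (fun s hs => Set.subset_union_left.trans (hE s hs)) xs
    · exact h₂ G hXG hG (fun s hs => Set.subset_union_right.trans (hE s hs)) xs
  | @all n φ ih =>
    obtain ⟨E, hEκ, hEφ⟩ := ih
    choose D hD hDw using hEφ.not.exists_witnesses hκ hX hw hEκ
    refine ⟨fun s => E s ∪ D s, fun s => mk_union_le_of_le hκ.le (hEκ s) (hD s),
      fun G hXG hG hE xs => ?_⟩
    have hreal : ∀ b : Substructure.closure L G, φ.Realize default (Fin.snoc xs b : Fin (n + 1) → _) ↔
        φ.Realize default (Fin.snoc (fun i => (xs i : H)) (b : H) : Fin (n + 1) → H) := by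
      intro b
      rw [hEφ G hXG hG (fun s hs => Set.subset_union_left.trans (hE s hs))]
      refine iff_of_eq (congrArg _ (funext (Fin.lastCases ?_ fun i => ?_))) <;> simp
    rw [BoundedFormula.realize_all, BoundedFormula.realize_all]
    refine ⟨fun h b => ?_, fun h b => (hreal b).2 (h b)⟩
    by_contra hb
    obtain ⟨s, hs, hxs⟩ := exists_finset_forall_mem_closure fun i => (xs i).2
    obtain ⟨b', hb'D, hb'⟩ := hDw s _ hxs b hb
    exact hb' ((hreal ⟨b', Substructure.closure_mono
      (Set.subset_union_right.trans (hE s hs)) hb'D⟩).1 (h _))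

end Reflection

section StrictlyGenerated

theorem BoundedFormula.IsUniversal.alls {L : FirstOrder.Language.{u, u}} {n : ℕ}
    {ψ : L.BoundedFormula Empty n} (h : ψ.IsUniversal) : ψ.alls.IsUniversal := by
  induction n with
  | zero => exact h
  | succ n ih => exact ih h.all

theorem IsUniversalTheory.isUniversal {L : FirstOrder.Language.{u, u}} {T : L.Theory}
    (hT : IsUniversalTheory T) : T.IsUniversal where
  isUniversal_of_mem φ hφ := by
    obtain ⟨n, ψ, hψ, rfl⟩ := hT φ hφ
    exact BoundedFormula.IsUniversal.alls (.of_isQF hψ)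

variable {L : FirstOrder.Language.{u, u}} {H : Type u} [L.Structure H]

theorem generates_preimage_closure (G : Set H) :
    Generates L (Substructure.closure L G)
      ((↑) ⁻¹' G : Set (Substructure.closure L G)) := by
  apply Substructure.map_injective_of_injective
    (f := (Substructure.closure L G).subtype.toHom) Subtype.val_injective
  have hG : G ⊆ Set.range ((↑) : Substructure.closure L G → H) := by
    simp
  rw [Substructure.map_closure]
  change Substructure.closure L
    (Subtype.val '' ((↑) ⁻¹' G : Set (Substructure.closure L G))) = _
  rw [Set.image_preimage_eq_of_subset hG]
  ext a
  simp [Substructure.mem_map]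

theorem mem_closure_image_of_generates {S : L.Substructure H} {Y : Set S} (hY : Generates L S Y)
    {a : H} (ha : a ∈ S) : a ∈ Substructure.closure L ((↑) '' Y : Set H) := by
  have h := Substructure.map_closure S.subtype.toHom Y
  rw [show Substructure.closure L Y = ⊤ from hY] at h
  change _ = Substructure.closure L ((↑) '' Y : Set H) at h
  rw [← h]
  exact ⟨⟨a, ha⟩, trivial, rfl⟩

theorem strictlyGenerated_closure {I : Type u} {κ : Cardinal.{u}} (hκ : ℵ₀ < κ) (hI : #I = κ)
    {x : I → H} {S : Set I → L.Substructure H} (hmono : Monotone S)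
    (hmem : ∀ A i, x i ∈ S A ↔ i ∈ A) (hfin : ∀ h, ∃ s : Finset I, h ∈ S s) {G : Set H}
    (hxG : Set.range x ⊆ G) (hG : #G = κ) : StrictlyGenerated L (Substructure.closure L G) κ := by
  refine ⟨⟨Subtype.val ⁻¹' G, ?_, generates_preimage_closure G⟩, ?_⟩
  · rw [mk_preimage_of_injective_of_subset_range _ _ Subtype.val_injective (by simp), hG]
  · rintro ν hν ⟨Y, rfl, hY⟩
    choose supp hsupp using hfin
    set A : Set I := ⋃ y : Y, (supp (y : Substructure.closure L G) : Set I) with hA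
    have hAκ : #A < κ := by
      refine lt_of_le_of_lt (mk_iUnion_le_of_forall_le (le_max_left ℵ₀ #Y) (le_max_right _ _)
        fun y => ?_) (max_lt hκ hν)
      exact (Finset.countable_toSet _).le_aleph0.trans (le_max_left _ _)
    obtain ⟨j, hj⟩ : ∃ j, j ∉ A := by
      by_contra! h
      rw [Set.eq_univ_of_forall h, mk_univ, hI] at hAκ
      exact hAκ.false
    refine hj ((hmem A j).1 ?_)
    refine Substructure.closure_le.2 ?_ (mem_closure_image_of_generates hY
      (Substructure.subset_closure (hxG ⟨j, rfl⟩)))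
    rintro _ ⟨y, hy, rfl⟩
    exact hmono (Set.subset_iUnion (fun y : Y => (supp (y : Substructure.closure L G) : Set I))
      ⟨y, hy⟩) (hsupp y)

theorem hasCountableWitnesses_closure_range {I : Type u} [LinearOrder I] [DenselyOrdered I]
    [NoMinOrder I] [NoMaxOrder I] [Nonempty I] {x : I → H} (hx : IsQFIndiscernible L x) :
    HasCountableWitnesses L (Substructure.closure L (Set.range x)) := by
  let x' : I → Substructure.closure L (Set.range x) :=
    fun i => ⟨x i, Substructure.subset_closure ⟨i, rfl⟩⟩
  have hx' : IsQFIndiscernible L x' := fun ι _ φ hφ w w' hw => by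
    have h := hx ι φ hφ w w' hw
    have key : ∀ w : ι → I, φ.Realize (x ∘ w) ↔ φ.Realize (x' ∘ w) := fun w => by
      have := hφ.realize_embedding (Substructure.closure L (Set.range x)).subtype
        (v := x' ∘ w) (xs := default)
      rw [Subsingleton.elim (_ ∘ default) default] at this
      exact this
    rwa [key, key] at h
  refine hx'.hasCountableWitnesses ?_
  have hr : Set.range x' = (↑) ⁻¹' Set.range x := by
    ext a
    simp [x', Subtype.ext_iff]
  rw [hr]
  exact generates_preimage_closure _

/-- For every infinite model `M` of a universal `κ`-unique theory and every sentence, there is a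
strictly `κ`-generated model of the theory that agrees with `M` on the sentence. -/
theorem KUnique.exists_strictlyGenerated_realize_iff {T : L.Theory}
    (hT : IsUniversalTheory T) {κ : Cardinal.{u}} (hκ : ℵ₀ < κ) (hTκ : KUnique T κ) (M : Type u)
    [L.Structure M] [Infinite M] [M ⊨ T] (φ : L.Sentence) :
    ∃ (N : Type u) (_ : L.Structure N),
      N ⊨ T ∧ StrictlyGenerated L N κ ∧ (N ⊨ φ ↔ M ⊨ φ) := by
  have := hT.isUniversal
  have : Nonempty κ.ord.ToType := by
    rw [← mk_ne_zero_iff, mk_ord_toType]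
    exact (aleph0_pos.trans hκ).ne'
  let I : Type u := κ.ord.ToType ×ₗ ℚ
  have hI : #I = κ := by
    change #(κ.ord.ToType × ℚ) = κ
    simpa using mul_eq_left hκ.le hκ.le aleph0_ne_zero
  obtain ⟨H, _, x, S, hHM, hmono, hmem, hfin, hind⟩ := exists_indiscernible_sequence L I M
  have hxinj : Function.Injective x := fun i j hij =>
    (hmem {j} i).1 (hij ▸ (hmem {j} j).2 rfl)
  have hX : #(Set.range x) = κ := (mk_range_eq x hxinj).trans hI
  have hH : H ⊨ T := hHM.symm.theory_model
  have hgen : ∀ G : Set H, Set.range x ⊆ G → #G ≤ κ →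
      StrictlyGenerated L (Substructure.closure L G) κ := fun G hG hGκ =>
    strictlyGenerated_closure hκ hI hmono hmem hfin hG
      (hGκ.antisymm (hX ▸ mk_le_mk_of_subset hG))
  have hw : ∀ G : Set H, Set.range x ⊆ G → #G ≤ κ →
      HasCountableWitnesses L (Substructure.closure L G) := fun G hG hGκ => by
    obtain ⟨e⟩ := hTκ.2 _ _ _ _ inferInstance inferInstance (hgen _ subset_rfl hX.le)
      (hgen G hG hGκ)
    exact (hasCountableWitnesses_closure_range fun ι _ φ _ => hind ι φ).of_equiv e
  obtain ⟨E, hEκ, hE⟩ := exists_reflects hκ hX.le hw φ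
  have hGκ := mk_closeUnder_le hκ.le hEκ hX.le
  refine ⟨Substructure.closure L (closeUnder E (Set.range x)), inferInstance, inferInstance,
    hgen _ (subset_closeUnder E _) hGκ, ?_⟩
  rw [← elementarilyEquivalent_iff.1 hHM φ]
  have h := hE _ (subset_closeUnder E _) hGκ (isClosedUnder_closeUnder E _) default
  rwa [Subsingleton.elim (fun i => _) (default : Fin 0 → H)] at h

theorem KUnique.elementarilyEquivalent {T : L.Theory} (hT : IsUniversalTheory T) {κ : Cardinal.{u}}
    (hκ : ℵ₀ < κ) (hTκ : KUnique T κ) (M N : Type u) [L.Structure M] [L.Structure N]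
    [Infinite M] [Infinite N] [M ⊨ T] [N ⊨ T] : M ≅[L] N := by
  refine elementarilyEquivalent_iff.2 fun φ => ?_
  obtain ⟨M', _, hM'T, hM', hφM⟩ :=
    hTκ.exists_strictlyGenerated_realize_iff hT hκ M φ
  obtain ⟨N', _, hN'T, hN', hφN⟩ :=
    hTκ.exists_strictlyGenerated_realize_iff hT hκ N φ
  obtain ⟨e⟩ := hTκ.2 M' N' _ _ hM'T hN'T hM' hN'
  rw [← hφM, ← hφN]
  exact StrongHomClass.realize_sentence e φ

theorem IsGenerated.infinite {M : Type u} [L.Structure M] {κ : Cardinal.{u}} (hκ : ℵ₀ ≤ κ)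
    (hM : IsGenerated L M κ) : Infinite M := by
  obtain ⟨X, rfl, -⟩ := hM
  exact infinite_iff.2 (hκ.trans (mk_set_le X))

end StrictlyGenerated

/-- If a universal theory `T` is `κ`-unique for some uncountable `κ`, then any two infinite
models of `T` are elementarily equivalent; equivalently, the theory `T_∞` of the infinite
models of `T` is a complete (satisfiable) theory. -/
theorem stmt1 {L : FirstOrder.Language.{u, u}} (T : L.Theory)
    (hTuniv : IsUniversalTheory T)
    (κ : Cardinal.{u}) (hκ : ℵ₀ < κ) (hTκ : KUnique T κ) :
    (∀ (M N : Type u) (_ : L.Structure M) (_ : L.Structure N),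
      M ⊨ T → N ⊨ T → Infinite M → Infinite N → M ≅[L] N) ∧
    Theory.IsComplete
      {φ : L.Sentence | ∀ (M : Type u) (_ : L.Structure M), M ⊨ T → Infinite M → M ⊨ φ} := by
  have hequiv : ∀ (M N : Type u) (_ : L.Structure M) (_ : L.Structure N),
      M ⊨ T → N ⊨ T → Infinite M → Infinite N → M ≅[L] N := fun M N _ _ _ _ _ _ =>
    hTκ.elementarilyEquivalent hTuniv hκ M N
  refine ⟨hequiv, ?_⟩
  obtain ⟨M, _, hMT, hM⟩ := hTκ.1
  have hMinf := hM.1.infinite hκ.le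
  have hMT' : M ⊨ {φ : L.Sentence | ∀ (M : Type u) (_ : L.Structure M),
      M ⊨ T → Infinite M → M ⊨ φ} :=
    Theory.model_iff _ |>.2 fun φ hφ => hφ M _ hMT hMinf
  refine ⟨Theory.Model.isSatisfiable M, fun φ => ?_⟩
  by_cases hφ : M ⊨ φ
  · exact .inl (Theory.models_sentence_of_mem fun N _ hNT hN =>
      (elementarilyEquivalent_iff.1 (hequiv M N _ _ hMT hNT hMinf hN) φ).1 hφ)
  · exact .inr (Theory.models_sentence_of_mem fun N _ hNT hN =>
      mt (elementarilyEquivalent_iff.1 (hequiv M N _ _ hMT hNT hMinf hN) φ).2 hφ)
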